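/- For the mixture Bernoulli process Q, one has 0 ≤ E_Q I^Q(n) ≤ log(n+1) for every n, and consequently δ⁺_Q = δ⁻_Q = 0. -/

import Mathlib

open MeasureTheory ProbabilityTheory Filter

noncomputable section

/-- The binary positive logarithm `log⁺ x`: `log(x+1)` for `x ≥ 0` and `0` for `x < 0`. -/
def logPlus (x : ℝ) : ℝ := if 0 ≤ x then Real.logb 2 (x + 1) else 0

variable {𝕏 : Type*}

/-- The left shift on two-sided sequences. -/
def shift (ω : ℤ → 𝕏) : ℤ → 𝕏 := fun i => ω (i + 1)

/-- The block `X_{-n+1}^0` of a two-sided sequence. -/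
def blockNeg (n : ℕ) (ω : ℤ → 𝕏) : Fin n → 𝕏 := fun i => ω (-(n : ℤ) + 1 + (i : ℕ))

/-- The block `X_1^n` of a two-sided sequence. -/
def blockPos (n : ℕ) (ω : ℤ → 𝕏) : Fin n → 𝕏 := fun i => ω (1 + (i : ℕ))

/-- The block `X_{-n+1}^n` of a two-sided sequence. -/
def blockBoth (n : ℕ) (ω : ℤ → 𝕏) : Fin (2 * n) → 𝕏 := fun i => ω (-(n : ℤ) + 1 + (i : ℕ))

/-- A code assigns nonnegative values to finite strings. -/
def CodeNonneg (P : (n : ℕ) → (Fin n → 𝕏) → ℝ) : Prop := ∀ n x, 0 ≤ P n x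

/-- A code satisfies the Kraft inequality `∑_{x_1^n} P(x_1^n) ≤ 1`. -/
def CodeKraft (P : (n : ℕ) → (Fin n → 𝕏) → ℝ) : Prop :=
  ∀ n, 1 ≤ n → ∑' x : Fin n → 𝕏, P n x ≤ 1

/-- The pointwise mutual information
`I^P(n) = -log P(X_{-n+1}^0) - log P(X_1^n) + log P(X_{-n+1}^n)` (binary logarithm). -/
def pmi (P : (n : ℕ) → (Fin n → 𝕏) → ℝ) (n : ℕ) (ω : ℤ → 𝕏) : ℝ :=
  -Real.logb 2 (P n (blockNeg n ω)) - Real.logb 2 (P n (blockPos n ω))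
    + Real.logb 2 (P (2 * n) (blockBoth n ω))

/-- The upper random Hilberg exponent `γ⁺_P = limsup_n log⁺ I^P(n) / log n`. -/
def gammaPlus (P : (n : ℕ) → (Fin n → 𝕏) → ℝ) (ω : ℤ → 𝕏) : ℝ :=
  limsup (fun n : ℕ => logPlus (pmi P n ω) / Real.logb 2 n) atTop

/-- The lower random Hilberg exponent `γ⁻_P = liminf_n log⁺ I^P(n) / log n`. -/
def gammaMinus (P : (n : ℕ) → (Fin n → 𝕏) → ℝ) (ω : ℤ → 𝕏) : ℝ :=
  liminf (fun n : ℕ => logPlus (pmi P n ω) / Real.logb 2 n) atTop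

variable [MeasurableSpace 𝕏]

/-- The upper expected Hilberg exponent `δ⁺_P = limsup_n log⁺ E_Q I^P(n) / log n`. -/
def deltaPlus (Q : Measure (ℤ → 𝕏)) (P : (n : ℕ) → (Fin n → 𝕏) → ℝ) : ℝ :=
  limsup (fun n : ℕ => logPlus (∫ ω, pmi P n ω ∂Q) / Real.logb 2 n) atTop

/-- The lower expected Hilberg exponent `δ⁻_P = liminf_n log⁺ E_Q I^P(n) / log n`. -/
def deltaMinus (Q : Measure (ℤ → 𝕏)) (P : (n : ℕ) → (Fin n → 𝕏) → ℝ) : ℝ :=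
  liminf (fun n : ℕ => logPlus (∫ ω, pmi P n ω ∂Q) / Real.logb 2 n) atTop

/-- The measure `Q` regarded as a code: `Q(x_1^n) = Q(X_1^n = x_1^n)`. -/
def measureCode (Q : Measure (ℤ → 𝕏)) : (n : ℕ) → (Fin n → 𝕏) → ℝ :=
  fun n x => (Q {ω | blockPos n ω = x}).toReal

/-- The upper inverse expected Hilberg exponent
`ζ⁺_P = limsup_n log⁺ [E_Q (I^P(n)+B)⁻¹]⁻¹ / log n`, for a constant `B`. -/
def zetaPlus (Q : Measure (ℤ → 𝕏)) (P : (n : ℕ) → (Fin n → 𝕏) → ℝ) (B : ℝ) : ℝ :=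
  limsup (fun n : ℕ => logPlus ((∫ ω, (pmi P n ω + B)⁻¹ ∂Q)⁻¹) / Real.logb 2 n) atTop

/-- The lower inverse expected Hilberg exponent
`ζ⁻_P = liminf_n log⁺ [E_Q (I^P(n)+B)⁻¹]⁻¹ / log n`, for a constant `B`. -/
def zetaMinus (Q : Measure (ℤ → 𝕏)) (P : (n : ℕ) → (Fin n → 𝕏) → ℝ) (B : ℝ) : ℝ :=
  liminf (fun n : ℕ => logPlus ((∫ ω, (pmi P n ω + B)⁻¹ ∂Q)⁻¹) / Real.logb 2 n) atTop

/-- The parameter `ε_P = limsup_n log⁺ [Var_Q I^P(n) / E_Q I^P(n)] / log n`. -/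
def epsilonExp (Q : Measure (ℤ → 𝕏)) (P : (n : ℕ) → (Fin n → 𝕏) → ℝ) : ℝ :=
  limsup (fun n : ℕ =>
    logPlus (variance (pmi P n) Q / ∫ ω, pmi P n ω ∂Q) / Real.logb 2 n) atTop

/-- `I^P` is nearly nondecreasing: for some `C ≥ 0`,
`I^P(n+m) ≥ I^P(n) - 4 log m - C` pointwise for all `n, m ≥ 1`. -/
def NearlyNondecreasing (P : (n : ℕ) → (Fin n → 𝕏) → ℝ) : Prop :=
  ∃ C : ℝ, 0 ≤ C ∧ ∀ n m : ℕ, 1 ≤ n → 1 ≤ m → ∀ ω : ℤ → 𝕏,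
    pmi P n ω - 4 * Real.logb 2 m - C ≤ pmi P (n + m) ω


/-- The mixture Bernoulli specification: `Q(X_1^n = x_1^n) = (n+1)⁻¹ binom(n, Σ x_i)⁻¹`. -/
def IsMixtureBernoulli (Q : Measure (ℤ → Bool)) : Prop :=
  ∀ n : ℕ, 1 ≤ n → ∀ x : Fin n → Bool,
    Q {ω | blockPos n ω = x} =
      ENNReal.ofReal
        (((n : ℝ) + 1)⁻¹ *
          ((n.choose ((Finset.univ.filter fun i : Fin n => x i = true).card) : ℝ))⁻¹)

/-- The first half of a string of length `2 * n`. -/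
def leftHalf {α : Type*} (n : ℕ) (x : Fin (2 * n) → α) : Fin n → α :=
  fun i => x ⟨i, by omega⟩

/-- The second half of a string of length `2 * n`. -/
def rightHalf {α : Type*} (n : ℕ) (x : Fin (2 * n) → α) : Fin n → α :=
  fun i => x ⟨n + i, by omega⟩

/-- The number of ones in a binary string. -/
def onesCount {n : ℕ} (x : Fin n → Bool) : ℕ :=
  (Finset.univ.filter fun i : Fin n => x i = true).card

theorem leftHalf_blockBoth {α : Type*} (n : ℕ) (ω : ℤ → α) :
    leftHalf n (blockBoth n ω) = blockNeg n ω := rfl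

theorem rightHalf_blockBoth {α : Type*} (n : ℕ) (ω : ℤ → α) :
    rightHalf n (blockBoth n ω) = blockPos n ω := by
  funext i
  simp only [rightHalf, blockBoth, blockPos]
  congr 1
  push_cast
  ring

theorem halves_injective {α : Type*} (n : ℕ) :
    Function.Injective fun x : Fin (2 * n) → α => (leftHalf n x, rightHalf n x) := by
  intro x y h
  obtain ⟨hl, hr⟩ := Prod.mk.inj h
  funext i
  by_cases hi : (i : ℕ) < n
  · exact congrFun hl ⟨i, hi⟩
  · have := congrFun hr ⟨i - n, by omega⟩
    simp only [rightHalf] at this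
    convert this using 2 <;> ext <;> simp <;> omega

theorem onesCount_halves (n : ℕ) (x : Fin (2 * n) → Bool) :
    onesCount x = onesCount (leftHalf n x) + onesCount (rightHalf n x) := by
  have key : ∀ (m : ℕ) (h : m = n + n) (y : Fin m → Bool),
      onesCount y = onesCount (fun i : Fin n => y ⟨i, by omega⟩) +
        onesCount (fun i : Fin n => y ⟨n + i, by omega⟩) := by
    rintro m rfl y
    simp only [onesCount, Finset.card_filter, Fin.sum_univ_add]
    rfl
  exact key _ (two_mul n) x

theorem onesCount_le {n : ℕ} (x : Fin n → Bool) : onesCount x ≤ n :=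
  (Finset.card_le_univ _).trans_eq (Fintype.card_fin n)

/-- One term of the Vandermonde convolution is at most the whole sum. -/
theorem choose_mul_choose_le (m n a b : ℕ) :
    m.choose a * n.choose b ≤ (m + n).choose (a + b) := by
  rw [Nat.add_choose_eq]
  exact Finset.single_le_sum (f := fun ij : ℕ × ℕ => m.choose ij.1 * n.choose ij.2)
    (fun _ _ => Nat.zero_le _) (Finset.HasAntidiagonal.mem_antidiagonal.2 (rfl : (a, b).1 + (a, b).2 = a + b))

theorem measurable_blockBoth {α : Type*} [MeasurableSpace α] (n : ℕ) :
    Measurable (blockBoth n : (ℤ → α) → _) :=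
  measurable_pi_lambda _ fun _ => measurable_pi_apply _

theorem measurable_blockPos {α : Type*} [MeasurableSpace α] (n : ℕ) :
    Measurable (blockPos n : (ℤ → α) → _) :=
  measurable_pi_lambda _ fun _ => measurable_pi_apply _

theorem shift_iterate_apply {α : Type*} (k : ℕ) (ω : ℤ → α) (i : ℤ) :
    shift^[k] ω i = ω (i + k) := by
  induction k generalizing ω with
  | zero => simp
  | succ k ih =>
    rw [Function.iterate_succ_apply, ih, shift]
    congr 1
    push_cast
    ring

theorem blockBoth_shift_iterate {α : Type*} (n : ℕ) (ω : ℤ → α) :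
    blockBoth n (shift^[n] ω) = blockPos (2 * n) ω := by
  funext i
  simp only [blockBoth, blockPos, shift_iterate_apply]
  congr 1
  ring

theorem measureCode_nonneg {α : Type*} [MeasurableSpace α] (Q : Measure (ℤ → α)) (n : ℕ)
    (x : Fin n → α) : 0 ≤ measureCode Q n x := ENNReal.toReal_nonneg

/-- Under a stationary measure, the two-sided block has the law of a one-sided block. -/
theorem measureReal_blockBoth_preimage {α : Type*} [MeasurableSpace α]
    [MeasurableSingletonClass α] {Q : Measure (ℤ → α)}
    (hstat : MeasurePreserving shift Q Q) (n : ℕ) (x : Fin (2 * n) → α) :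
    Q.real (blockBoth n ⁻¹' {x}) = measureCode Q (2 * n) x := by
  have h := (hstat.iterate n).measure_preimage
    ((measurable_blockBoth n (measurableSet_singleton x)).nullMeasurableSet)
  rw [Measure.real, ← h, measureCode]
  congr 2
  ext ω
  simp [blockBoth_shift_iterate]

section FiniteAlphabet

variable {α : Type*} [Fintype α] [MeasurableSpace α] [MeasurableSingletonClass α]

theorem integral_comp_blockBoth {Q : Measure (ℤ → α)} [IsProbabilityMeasure Q]
    (hstat : MeasurePreserving shift Q Q) (n : ℕ) (f : (Fin (2 * n) → α) → ℝ) :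
    ∫ ω, f (blockBoth n ω) ∂Q = ∑ x, measureCode Q (2 * n) x * f x := by
  have : IsProbabilityMeasure (Q.map (blockBoth n)) :=
    Measure.isProbabilityMeasure_map (measurable_blockBoth n).aemeasurable
  rw [← integral_map (measurable_blockBoth n).aemeasurable
    (measurable_of_finite f).aestronglyMeasurable, integral_fintype .of_finite]
  refine Finset.sum_congr rfl fun x _ => ?_
  rw [map_measureReal_apply (measurable_blockBoth n) (measurableSet_singleton x),
    measureReal_blockBoth_preimage hstat, smul_eq_mul]

theorem sum_measureCode (Q : Measure (ℤ → α)) [IsProbabilityMeasure Q] (n : ℕ) :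
    ∑ x, measureCode Q n x = 1 := by
  have h := sum_measureReal_preimage_singleton (μ := Q) (f := blockPos n) Finset.univ
    fun x _ => measurable_blockPos n (measurableSet_singleton x)
  rw [Finset.coe_univ, Set.preimage_univ, probReal_univ] at h
  exact h

theorem sum_measureCode_halves_le_one (Q : Measure (ℤ → α)) [IsProbabilityMeasure Q] (n : ℕ) :
    ∑ x, measureCode Q n (leftHalf n x) * measureCode Q n (rightHalf n x) ≤ 1 := by
  classical
  calc ∑ x, measureCode Q n (leftHalf n x) * measureCode Q n (rightHalf n x)
      = ∑ p ∈ Finset.univ.image fun x : Fin (2 * n) → α => (leftHalf n x, rightHalf n x),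
          measureCode Q n p.1 * measureCode Q n p.2 := by
        rw [Finset.sum_image (halves_injective n).injOn]
    _ ≤ ∑ p : (Fin n → α) × (Fin n → α), measureCode Q n p.1 * measureCode Q n p.2 :=
        Finset.sum_le_sum_of_subset_of_nonneg (Finset.subset_univ _) fun p _ _ =>
          mul_nonneg (measureCode_nonneg Q n _) (measureCode_nonneg Q n _)
    _ = 1 := by
        rw [Fintype.sum_prod_type, ← Fintype.sum_mul_sum, sum_measureCode, one_mul]

/-- The expected mutual information as a finite sum over two-sided blocks. -/
theorem integral_pmi {Q : Measure (ℤ → α)} [IsProbabilityMeasure Q]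
    (hstat : MeasurePreserving shift Q Q) (n : ℕ) :
    ∫ ω, pmi (measureCode Q) n ω ∂Q =
      ∑ x, measureCode Q (2 * n) x *
        (-Real.logb 2 (measureCode Q n (leftHalf n x)) -
          Real.logb 2 (measureCode Q n (rightHalf n x)) +
          Real.logb 2 (measureCode Q (2 * n) x)) := by
  rw [← integral_comp_blockBoth hstat n]
  simp only [leftHalf_blockBoth, rightHalf_blockBoth, pmi]

/-- Mutual information of adjacent blocks is nonnegative for a code of full support. -/
theorem integral_pmi_nonneg {Q : Measure (ℤ → α)} [IsProbabilityMeasure Q]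
    (hstat : MeasurePreserving shift Q Q) (n : ℕ)
    (hpos : ∀ x : Fin n → α, 0 < measureCode Q n x)
    (hpos₂ : ∀ x : Fin (2 * n) → α, 0 < measureCode Q (2 * n) x) :
    0 ≤ ∫ ω, pmi (measureCode Q) n ω ∂Q := by
  have hlog : 0 < Real.log 2 := Real.log_pos one_lt_two
  rw [integral_pmi hstat]
  have hterm : ∀ x : Fin (2 * n) → α,
      (measureCode Q (2 * n) x - measureCode Q n (leftHalf n x) * measureCode Q n (rightHalf n x))
          / Real.log 2 ≤
        measureCode Q (2 * n) x *
        (-Real.logb 2 (measureCode Q n (leftHalf n x)) -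
          Real.logb 2 (measureCode Q n (rightHalf n x)) +
          Real.logb 2 (measureCode Q (2 * n) x)) := by
    intro x
    have hl := hpos (leftHalf n x)
    have hr := hpos (rightHalf n x)
    have hb := hpos₂ x
    set l := measureCode Q n (leftHalf n x)
    set r := measureCode Q n (rightHalf n x)
    set b := measureCode Q (2 * n) x
    have h := Real.log_le_sub_one_of_pos (show 0 < l * r / b by positivity)
    rw [Real.log_div (by positivity) (by positivity), Real.log_mul hl.ne' hr.ne'] at h
    have h' := mul_le_mul_of_nonneg_left h hb.le
    have hcancel : b * (l * r / b - 1) = l * r - b := by field_simp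
    rw [hcancel] at h'
    simp only [Real.logb]
    rw [show b * (-(Real.log l / Real.log 2) - Real.log r / Real.log 2 +
      Real.log b / Real.log 2) = (b * (-Real.log l - Real.log r + Real.log b)) / Real.log 2 by ring]
    gcongr
    linarith
  refine le_trans ?_ (Finset.sum_le_sum fun x _ => hterm x)
  rw [← Finset.sum_div, Finset.sum_sub_distrib, sum_measureCode]
  exact div_nonneg (sub_nonneg.2 (sum_measureCode_halves_le_one Q n)) hlog.le

end FiniteAlphabet

theorem IsMixtureBernoulli.measureCode_eq {Q : Measure (ℤ → Bool)} (hQ : IsMixtureBernoulli Q)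
    {n : ℕ} (hn : 1 ≤ n) (x : Fin n → Bool) :
    measureCode Q n x = ((n : ℝ) + 1)⁻¹ * (n.choose (onesCount x) : ℝ)⁻¹ := by
  rw [measureCode, hQ n hn x, ENNReal.toReal_ofReal (by positivity), onesCount]

theorem IsMixtureBernoulli.measureCode_pos {Q : Measure (ℤ → Bool)} (hQ : IsMixtureBernoulli Q)
    {n : ℕ} (hn : 1 ≤ n) (x : Fin n → Bool) : 0 < measureCode Q n x := by
  have : 0 < n.choose (onesCount x) := Nat.choose_pos (onesCount_le x)
  rw [hQ.measureCode_eq hn]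
  positivity

theorem IsMixtureBernoulli.measureCode_le {Q : Measure (ℤ → Bool)} (hQ : IsMixtureBernoulli Q)
    {n : ℕ} (hn : 1 ≤ n) (x : Fin (2 * n) → Bool) :
    measureCode Q (2 * n) x ≤
      ((n : ℝ) + 1) * (measureCode Q n (leftHalf n x) * measureCode Q n (rightHalf n x)) := by
  rw [hQ.measureCode_eq hn, hQ.measureCode_eq hn, hQ.measureCode_eq (by omega),
    onesCount_halves]
  have ha : 0 < n.choose (onesCount (leftHalf n x)) := Nat.choose_pos (onesCount_le _)
  have hb : 0 < n.choose (onesCount (rightHalf n x)) := Nat.choose_pos (onesCount_le _)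
  have hle := choose_mul_choose_le n n (onesCount (leftHalf n x)) (onesCount (rightHalf n x))
  rw [← two_mul] at hle
  set a := n.choose (onesCount (leftHalf n x))
  set b := n.choose (onesCount (rightHalf n x))
  set c := (2 * n).choose (onesCount (leftHalf n x) + onesCount (rightHalf n x))
  have hle' : (a : ℝ) * b ≤ c := by exact_mod_cast hle
  have hab : (0 : ℝ) < (a : ℝ) * b := by positivity
  calc (((2 * n : ℕ) : ℝ) + 1)⁻¹ * (c : ℝ)⁻¹ ≤ ((n : ℝ) + 1)⁻¹ * ((a : ℝ) * b)⁻¹ := by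
        gcongr
        omega
    _ = ((n : ℝ) + 1) * (((n : ℝ) + 1)⁻¹ * (a : ℝ)⁻¹ * (((n : ℝ) + 1)⁻¹ * (b : ℝ)⁻¹)) := by
        field_simp

theorem IsMixtureBernoulli.integral_pmi_le {Q : Measure (ℤ → Bool)} [IsProbabilityMeasure Q]
    (hstat : MeasurePreserving shift Q Q) (hQ : IsMixtureBernoulli Q) {n : ℕ} (hn : 1 ≤ n) :
    ∫ ω, pmi (measureCode Q) n ω ∂Q ≤ Real.logb 2 ((n : ℝ) + 1) := by
  rw [integral_pmi hstat]
  calc _ ≤ ∑ x, measureCode Q (2 * n) x * Real.logb 2 ((n : ℝ) + 1) := by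
        refine Finset.sum_le_sum fun x _ =>
          mul_le_mul_of_nonneg_left ?_ (measureCode_nonneg Q _ x)
        have hl := hQ.measureCode_pos hn (leftHalf n x)
        have hr := hQ.measureCode_pos hn (rightHalf n x)
        have h := Real.logb_le_logb_of_le one_lt_two (hQ.measureCode_pos (by omega) x)
          (hQ.measureCode_le hn x)
        rw [Real.logb_mul (by positivity) (by positivity),
          Real.logb_mul hl.ne' hr.ne'] at h
        linarith
    _ = Real.logb 2 ((n : ℝ) + 1) := by
        rw [← Finset.sum_mul, sum_measureCode, one_mul]

theorem logPlus_nonneg (x : ℝ) : 0 ≤ logPlus x := by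
  unfold logPlus
  split_ifs with h
  · exact Real.logb_nonneg one_lt_two (by linarith)
  · exact le_rfl

/-- A nonnegative sequence of at most logarithmic growth has vanishing growth exponent. -/
theorem tendsto_logPlus_div_logb_zero {u : ℕ → ℝ}
    (hu : ∀ n : ℕ, 1 ≤ n → 0 ≤ u n ∧ u n ≤ Real.logb 2 ((n : ℝ) + 1)) :
    Tendsto (fun n : ℕ => logPlus (u n) / Real.logb 2 n) atTop (nhds 0) := by
  have hlogb : Tendsto (fun n : ℕ => Real.logb 2 (n : ℝ)) atTop atTop :=
    (Real.tendsto_logb_atTop one_lt_two).comp tendsto_natCast_atTop_atTop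
  have hdom : Tendsto (fun t : ℝ => (1 + Real.logb 2 t) / t) atTop (nhds 0) := by
    have h₁ : Tendsto (fun t : ℝ => Real.log t / t) atTop (nhds 0) :=
      Real.isLittleO_log_id_atTop.tendsto_div_nhds_zero
    have h₂ := tendsto_inv_atTop_zero.add (h₁.div_const (Real.log 2))
    rw [zero_div, add_zero] at h₂
    refine h₂.congr fun t => ?_
    rw [Real.logb]
    ring
  refine tendsto_of_tendsto_of_tendsto_of_le_of_le' tendsto_const_nhds (hdom.comp hlogb) ?_ ?_
  · filter_upwards [hlogb.eventually_ge_atTop 2] with n hn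
    exact div_nonneg (logPlus_nonneg _) (by linarith)
  · filter_upwards [hlogb.eventually_ge_atTop 2, eventually_ge_atTop 1] with n hn hn1
    obtain ⟨h0, h1⟩ := hu n hn1
    have hn1' : (1 : ℝ) ≤ n := by exact_mod_cast hn1
    have hstep : Real.logb 2 ((n : ℝ) + 1) ≤ 1 + Real.logb 2 n := by
      have h := Real.logb_le_logb_of_le one_lt_two (by positivity)
        (show (n : ℝ) + 1 ≤ 2 * n by linarith)
      rwa [Real.logb_mul two_ne_zero (by positivity),
        Real.logb_self_eq_one one_lt_two] at h
    simp only [Function.comp_apply]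
    set t := Real.logb 2 (n : ℝ)
    have hlog := Real.logb_le_logb_of_le one_lt_two (by positivity)
      (show u n + 1 ≤ 2 * t by linarith)
    rw [Real.logb_mul two_ne_zero (by linarith), Real.logb_self_eq_one one_lt_two] at hlog
    rw [logPlus, if_pos h0]
    gcongr

/-- For the mixture Bernoulli process `Q`, we have
`0 ≤ E_Q I^Q(n) ≤ log(n+1)` for every `n`, and consequently `δ⁺_Q = δ⁻_Q = 0`. -/
theorem mixtureBernoulli_expected_exponents (Q : Measure (ℤ → Bool))
    [IsProbabilityMeasure Q] (hstat : MeasurePreserving shift Q Q)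
    (hQ : IsMixtureBernoulli Q) :
    (∀ n : ℕ, 1 ≤ n →
      0 ≤ ∫ ω, pmi (measureCode Q) n ω ∂Q ∧
      ∫ ω, pmi (measureCode Q) n ω ∂Q ≤ Real.logb 2 ((n : ℝ) + 1)) ∧
    deltaPlus Q (measureCode Q) = 0 ∧ deltaMinus Q (measureCode Q) = 0 := by
  have hbounds : ∀ n : ℕ, 1 ≤ n →
      0 ≤ ∫ ω, pmi (measureCode Q) n ω ∂Q ∧
      ∫ ω, pmi (measureCode Q) n ω ∂Q ≤ Real.logb 2 ((n : ℝ) + 1) := fun n hn =>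
    ⟨integral_pmi_nonneg hstat n (hQ.measureCode_pos hn) (hQ.measureCode_pos (by omega)),
      hQ.integral_pmi_le hstat hn⟩
  have hlim := tendsto_logPlus_div_logb_zero hbounds
  exact ⟨hbounds, hlim.limsup_eq, hlim.liminf_eq⟩
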